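/- There exist constants c, C > 0 such that for every ψ∈ℬ*: c·inf{‖ψ−φ‖_{ℬ*} : φ∈ℬ*₀} ≤ limsup_{n→∞} 2^{−n/2}·‖1_{{|x|<2ⁿ}}·ψ‖_{L²} ≤ C·inf{‖ψ−φ‖_{ℬ*} : φ∈ℬ*₀}; that is, the quantity ‖ψ‖_quo := limsup_{n→∞} 2^{−n/2}‖Σ_{m=0}^n F_m ψ‖_{L²} is a norm on the quotient ℬ*/ℬ*₀ equivalent to the abstract quotient norm. -/

import Mathlib

open MeasureTheory Filter
open scoped ENNReal

noncomputable section

/-- The dyadic annuli: `ann d 0 = {|x| < 1}` and `ann d m = {2^{m-1} ≤ |x| < 2^m}` for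
`m ≥ 1`. Multiplication by the indicator of `ann d m` is the operator `F_m`. -/
def ann (d m : ℕ) : Set (EuclideanSpace ℝ (Fin d)) :=
  if m = 0 then {x | ‖x‖ < 1} else {x | 2 ^ (m - 1) ≤ ‖x‖ ∧ ‖x‖ < 2 ^ m}

/-- The sequence `m ↦ 2^{-m/2} ‖F_m ψ‖_{L²}` (valued in `ℝ≥0∞`). -/
def pieceSeq (d : ℕ) (ψ : EuclideanSpace ℝ (Fin d) → ℝ) (m : ℕ) : ℝ≥0∞ :=
  ENNReal.ofReal (2 ^ (-(m : ℝ) / 2)) * eLpNorm ψ 2 (volume.restrict (ann d m))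

/-- The Besov norm `‖ψ‖_{ℬ*} = sup_m 2^{-m/2} ‖F_m ψ‖_{L²}`. -/
def bstarNorm (d : ℕ) (ψ : EuclideanSpace ℝ (Fin d) → ℝ) : ℝ :=
  (⨆ m, pieceSeq d ψ m).toReal

/-- Membership in `ℬ*`. -/
def MemBStar (d : ℕ) (ψ : EuclideanSpace ℝ (Fin d) → ℝ) : Prop :=
  AEStronglyMeasurable ψ volume ∧ (⨆ m, pieceSeq d ψ m) < ⊤

/-- Membership in `ℬ*₀`. -/
def MemBStar0 (d : ℕ) (ψ : EuclideanSpace ℝ (Fin d) → ℝ) : Prop :=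
  MemBStar d ψ ∧ Tendsto (fun m => pieceSeq d ψ m) atTop (nhds 0)

/-- The abstract quotient norm of `ψ` in `ℬ*/ℬ*₀`:
`inf {‖ψ - φ‖_{ℬ*} : φ ∈ ℬ*₀}`. -/
def quoDist (d : ℕ) (ψ : EuclideanSpace ℝ (Fin d) → ℝ) : ℝ :=
  sInf {r : ℝ | ∃ φ : EuclideanSpace ℝ (Fin d) → ℝ,
    MemBStar0 d φ ∧ bstarNorm d (ψ - φ) = r}

/-- The quantity `‖ψ‖_quo = limsup_{n → ∞} 2^{-n/2} ‖1_{{|x| < 2ⁿ}} ψ‖_{L²}`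
`= limsup_{n → ∞} 2^{-n/2} ‖Σ_{m ≤ n} F_m ψ‖_{L²}`. -/
def limsupQuo (d : ℕ) (ψ : EuclideanSpace ℝ (Fin d) → ℝ) : ℝ :=
  limsup (fun n : ℕ =>
    (ENNReal.ofReal (2 ^ (-(n : ℝ) / 2)) *
      eLpNorm ψ 2 (volume.restrict {x | ‖x‖ < 2 ^ n})).toReal) atTop

/-- A sequence with `x (n + 1) ≤ r x n + c` eventually enters every neighbourhood of the
half-line below the fixed point `c / (1 - r)`. -/
lemma eventually_le_of_succ_le_mul_add {x : ℕ → ℝ} {r c : ℝ} (hr0 : 0 ≤ r) (hr1 : r < 1)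
    (h : ∀ᶠ n in atTop, x (n + 1) ≤ r * x n + c) {ε : ℝ} (hε : 0 < ε) :
    ∀ᶠ n in atTop, x n ≤ c / (1 - r) + ε := by
  obtain ⟨N, hN⟩ := eventually_atTop.1 h
  have hr : (1 : ℝ) - r ≠ 0 := by linarith
  have key : ∀ k, x (k + N) ≤ r ^ k * (x N - c / (1 - r)) + c / (1 - r) := by
    intro k
    induction k with
    | zero => simp
    | succ k ih =>
      have h1 := hN (k + N) (by omega)
      have h2 := mul_le_mul_of_nonneg_left ih hr0
      have h3 : r * (c / (1 - r)) + c = c / (1 - r) := by field_simp; ring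
      rw [show k + 1 + N = k + N + 1 by ring, pow_succ]
      linarith
  have lim : Tendsto (fun k : ℕ => r ^ k * (x N - c / (1 - r))) atTop (nhds 0) := by
    simpa using (tendsto_pow_atTop_nhds_zero_of_lt_one hr0 hr1).mul_const (x N - c / (1 - r))
  have ev : ∀ᶠ k in atTop, x (k + N) ≤ c / (1 - r) + ε := by
    filter_upwards [lim.eventually (gt_mem_nhds hε)] with k hk
    linarith [key k]
  filter_upwards [(tendsto_sub_atTop_nat N).eventually ev, eventually_ge_atTop N] with n hn hNn
  rwa [Nat.sub_add_cancel hNn] at hn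

lemma eLpNorm_restrict_union_le {α : Type*} [MeasurableSpace α] {μ : Measure α} {f : α → ℝ}
    {s t : Set α} {p : ℝ≥0∞} (hp : 1 ≤ p) (hf : AEStronglyMeasurable f μ) (hs : MeasurableSet s)
    (ht : MeasurableSet t) (hst : Disjoint s t) :
    eLpNorm f p (μ.restrict (s ∪ t)) ≤
      eLpNorm f p (μ.restrict s) + eLpNorm f p (μ.restrict t) := by
  rw [← eLpNorm_indicator_eq_eLpNorm_restrict (hs.union ht),
    ← eLpNorm_indicator_eq_eLpNorm_restrict hs, ← eLpNorm_indicator_eq_eLpNorm_restrict ht,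
    Set.indicator_union_of_disjoint hst]
  exact eLpNorm_add_le (hf.indicator hs) (hf.indicator ht) hp

section Dyadic

variable {d : ℕ}

lemma measurableSet_norm_lt (r : ℝ) :
    MeasurableSet {x : EuclideanSpace ℝ (Fin d) | ‖x‖ < r} :=
  measurableSet_lt measurable_norm measurable_const

lemma measurableSet_ann (m : ℕ) : MeasurableSet (ann d m) := by
  unfold ann
  split_ifs
  · exact measurableSet_norm_lt 1
  · exact (measurableSet_le measurable_const measurable_norm).inter (measurableSet_norm_lt _)

lemma ann_subset_norm_lt {m n : ℕ} (hmn : m ≤ n) :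
    ann d m ⊆ {x | ‖x‖ < 2 ^ n} := by
  have h2 : (2 : ℝ) ^ m ≤ 2 ^ n := pow_le_pow_right₀ (by norm_num) hmn
  intro x hx
  unfold ann at hx
  split_ifs at hx with hm
  · subst hm
    exact lt_of_lt_of_le hx (by simpa using h2)
  · exact hx.2.trans_le h2

lemma disjoint_norm_lt_ann {m n : ℕ} (hnm : n < m) :
    Disjoint {x | ‖x‖ < 2 ^ n} (ann d m) := by
  refine Set.disjoint_left.2 fun x hx hx' => ?_
  rw [ann, if_neg (by omega)] at hx'
  have h2 : (2 : ℝ) ^ n ≤ 2 ^ (m - 1) := pow_le_pow_right₀ (by norm_num) (by omega)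
  exact absurd (lt_of_lt_of_le hx h2) (not_lt.2 hx'.1)

lemma norm_lt_succ_eq_union (n : ℕ) :
    {x : EuclideanSpace ℝ (Fin d) | ‖x‖ < 2 ^ (n + 1)} = {x | ‖x‖ < 2 ^ n} ∪ ann d (n + 1) := by
  refine Set.Subset.antisymm (fun x hx => ?_)
    (Set.union_subset (fun x hx => ?_) (ann_subset_norm_lt le_rfl))
  · rcases lt_or_ge ‖x‖ (2 ^ n) with h | h
    · exact Or.inl h
    · right
      simpa [ann] using ⟨h, hx⟩
  · have h2 : (2 : ℝ) ^ n ≤ 2 ^ (n + 1) := pow_le_pow_right₀ (by norm_num) (Nat.le_succ n)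
    exact lt_of_lt_of_le hx h2

/-- The sequence `n ↦ 2^{-n/2} ‖1_{|x| < 2ⁿ} ψ‖_{L²}`. -/
def ballSeq (d : ℕ) (ψ : EuclideanSpace ℝ (Fin d) → ℝ) (n : ℕ) : ℝ≥0∞ :=
  ENNReal.ofReal (2 ^ (-(n : ℝ) / 2)) * eLpNorm ψ 2 (volume.restrict {x | ‖x‖ < 2 ^ n})

variable {ψ φ : EuclideanSpace ℝ (Fin d) → ℝ}

lemma pieceSeq_le_ballSeq (n : ℕ) : pieceSeq d ψ n ≤ ballSeq d ψ n :=
  mul_le_mul_right (eLpNorm_mono_measure _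
    (Measure.restrict_mono (ann_subset_norm_lt le_rfl) le_rfl)) _

lemma two_rpow_neg_half_le : (2 : ℝ) ^ (-(1 : ℝ) / 2) ≤ 3 / 4 := by
  rw [show (-(1 : ℝ) / 2) = -(1 / 2) by ring, Real.rpow_neg (by norm_num), ← Real.sqrt_eq_rpow]
  have h : (4 / 3 : ℝ) ≤ √2 := Real.le_sqrt_of_sq_le (by norm_num)
  exact (inv_anti₀ (by norm_num) h).trans (by norm_num)

lemma ballSeq_succ_le (hψ : AEStronglyMeasurable ψ volume) (n : ℕ) :
    ballSeq d ψ (n + 1) ≤ ENNReal.ofReal (3 / 4) * ballSeq d ψ n + pieceSeq d ψ (n + 1) := by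
  have hpow : (2 : ℝ) ^ (-((n + 1 : ℕ) : ℝ) / 2) ≤ 3 / 4 * 2 ^ (-(n : ℝ) / 2) := by
    rw [show (-((n + 1 : ℕ) : ℝ) / 2) = -(1 : ℝ) / 2 + -(n : ℝ) / 2 by push_cast; ring,
      Real.rpow_add (by norm_num)]
    exact mul_le_mul_of_nonneg_right two_rpow_neg_half_le (by positivity)
  unfold ballSeq pieceSeq
  rw [norm_lt_succ_eq_union]
  calc _ ≤ _ := mul_le_mul_right (eLpNorm_restrict_union_le (by norm_num) hψ
          (measurableSet_norm_lt _) (measurableSet_ann _)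
          (disjoint_norm_lt_ann (Nat.lt_succ_self n))) _
    _ ≤ _ := by
      rw [mul_add, ← mul_assoc, ← ENNReal.ofReal_mul (by norm_num)]
      gcongr

lemma ballSeq_lt_top (hψ : MemBStar d ψ) (n : ℕ) : ballSeq d ψ n < ⊤ := by
  have hp : ∀ m, pieceSeq d ψ m < ⊤ := fun m => (le_iSup _ m).trans_lt hψ.2
  induction n with
  | zero =>
    have h := hp 0
    simpa [ballSeq, pieceSeq, ann] using h
  | succ n ih =>
    exact (ballSeq_succ_le hψ.1 n).trans_lt
      (ENNReal.add_lt_top.2 ⟨ENNReal.mul_lt_top ENNReal.ofReal_lt_top ih, hp _⟩)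

lemma toReal_ballSeq_succ_le (hψ : MemBStar d ψ) {n : ℕ} {c : ℝ} (hc : 0 ≤ c)
    (h : pieceSeq d ψ (n + 1) ≤ ENNReal.ofReal c) :
    (ballSeq d ψ (n + 1)).toReal ≤ 3 / 4 * (ballSeq d ψ n).toReal + c := by
  refine ENNReal.toReal_le_of_le_ofReal (by positivity) ?_
  rw [ENNReal.ofReal_add (by positivity) hc, ENNReal.ofReal_mul (by norm_num),
    ENNReal.ofReal_toReal (ballSeq_lt_top hψ n).ne]
  exact (ballSeq_succ_le hψ.1 n).trans (by gcongr)

lemma pieceSeq_le_bstarNorm (hψ : MemBStar d ψ) (m : ℕ) :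
    pieceSeq d ψ m ≤ ENNReal.ofReal (bstarNorm d ψ) := by
  rw [bstarNorm, ENNReal.ofReal_toReal hψ.2.ne]
  exact le_iSup _ m

lemma bstarNorm_nonneg : 0 ≤ bstarNorm d ψ := ENNReal.toReal_nonneg

lemma isBoundedUnder_ballSeq (hψ : MemBStar d ψ) :
    IsBoundedUnder (· ≤ ·) atTop fun n => (ballSeq d ψ n).toReal :=
  ⟨_, eventually_map.2 <| eventually_le_of_succ_le_mul_add (by norm_num) (by norm_num)
    (Eventually.of_forall fun n =>
      toReal_ballSeq_succ_le hψ bstarNorm_nonneg (pieceSeq_le_bstarNorm hψ (n + 1))) one_pos⟩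

lemma limsupQuo_le_of_eventually (hψ : MemBStar d ψ) {c : ℝ} (hc : 0 ≤ c)
    (h : ∀ᶠ n in atTop, pieceSeq d ψ n ≤ ENNReal.ofReal c) : limsupQuo d ψ ≤ 4 * c := by
  refine le_of_forall_pos_le_add fun ε hε => ?_
  have hcob : IsCoboundedUnder (· ≤ ·) atTop fun n => (ballSeq d ψ n).toReal :=
    (isBoundedUnder_of ⟨0, fun _ => ENNReal.toReal_nonneg⟩ :
      IsBoundedUnder (· ≥ ·) atTop _).isCoboundedUnder_le
  refine limsup_le_of_le hcob ?_
  have := eventually_le_of_succ_le_mul_add (x := fun n => (ballSeq d ψ n).toReal)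
    (r := 3 / 4) (c := c) (by norm_num) (by norm_num)
    (((tendsto_add_atTop_nat 1).eventually h).mono fun n hn => toReal_ballSeq_succ_le hψ hc hn) hε
  rwa [show c / (1 - 3 / 4) = 4 * c by ring] at this

lemma pieceSeq_add_le (hψ : AEStronglyMeasurable ψ volume) (hφ : AEStronglyMeasurable φ volume)
    (m : ℕ) : pieceSeq d (ψ + φ) m ≤ pieceSeq d ψ m + pieceSeq d φ m := by
  unfold pieceSeq
  rw [← mul_add]
  exact mul_le_mul_right (eLpNorm_add_le hψ.restrict hφ.restrict (by norm_num)) _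

lemma pieceSeq_neg (m : ℕ) : pieceSeq d (-ψ) m = pieceSeq d ψ m := by
  simp [pieceSeq, eLpNorm_neg]

lemma MemBStar.sub (hψ : MemBStar d ψ) (hφ : MemBStar d φ) : MemBStar d (ψ - φ) := by
  refine ⟨hψ.1.sub hφ.1, lt_of_le_of_lt (iSup_le fun m => ?_) (ENNReal.add_lt_top.2 ⟨hψ.2, hφ.2⟩)⟩
  rw [sub_eq_add_neg]
  refine (pieceSeq_add_le hψ.1 hφ.1.neg m).trans ?_
  rw [pieceSeq_neg]
  exact add_le_add (le_iSup _ m) (le_iSup _ m)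

lemma limsupQuo_le_bstarNorm_sub (hψ : MemBStar d ψ) (hφ : MemBStar0 d φ) :
    limsupQuo d ψ ≤ 4 * bstarNorm d (ψ - φ) := by
  refine le_of_forall_pos_le_add fun ε hε => ?_
  have hnn : 0 ≤ bstarNorm d (ψ - φ) := bstarNorm_nonneg
  have hsub := hψ.sub hφ.1
  have hev : ∀ᶠ n in atTop,
      pieceSeq d ψ n ≤ ENNReal.ofReal (bstarNorm d (ψ - φ) + ε / 4) := by
    filter_upwards [hφ.2.eventually
      (gt_mem_nhds (ENNReal.ofReal_pos.2 (show 0 < ε / 4 by positivity)))] with n hn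
    rw [ENNReal.ofReal_add hnn (by positivity)]
    calc pieceSeq d ψ n = pieceSeq d (ψ - φ + φ) n := by rw [sub_add_cancel]
      _ ≤ _ := pieceSeq_add_le hsub.1 hφ.1.1 n
      _ ≤ _ := add_le_add (pieceSeq_le_bstarNorm hsub n) hn.le
  linarith [limsupQuo_le_of_eventually hψ (by positivity) hev]

lemma pieceSeq_congr {m : ℕ} (h : Set.EqOn ψ φ (ann d m)) : pieceSeq d ψ m = pieceSeq d φ m := by
  unfold pieceSeq
  rw [eLpNorm_congr_ae (ae_restrict_of_forall_mem (measurableSet_ann m) h)]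

lemma pieceSeq_eq_zero {m : ℕ} (h : Set.EqOn ψ 0 (ann d m)) : pieceSeq d ψ m = 0 := by
  rw [pieceSeq_congr h]
  simp [pieceSeq]

lemma bddBelow_quoDist :
    BddBelow {r : ℝ | ∃ φ : EuclideanSpace ℝ (Fin d) → ℝ,
      MemBStar0 d φ ∧ bstarNorm d (ψ - φ) = r} :=
  ⟨0, by rintro _ ⟨φ, -, rfl⟩; exact bstarNorm_nonneg⟩

lemma memBStar0_zero : MemBStar0 d 0 := by
  have h : pieceSeq d 0 = 0 := funext fun m => pieceSeq_eq_zero fun _ _ => rfl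
  refine ⟨⟨aestronglyMeasurable_const, ?_⟩, ?_⟩ <;> simp [h]

lemma memBStar0_indicator (hψ : MemBStar d ψ) (N : ℕ) :
    MemBStar0 d ({x | ‖x‖ < 2 ^ N}.indicator ψ) := by
  have hlarge : ∀ m, N < m → pieceSeq d ({x | ‖x‖ < 2 ^ N}.indicator ψ) m = 0 := fun m hm =>
    pieceSeq_eq_zero fun x hx =>
      Set.indicator_of_notMem (Set.disjoint_right.1 (disjoint_norm_lt_ann hm) hx) ψ
  refine ⟨⟨hψ.1.indicator (measurableSet_norm_lt _),
    (iSup_mono fun m => ?_).trans_lt hψ.2⟩, ?_⟩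
  · rcases le_or_gt m N with hm | hm
    · exact (pieceSeq_congr fun x hx => Set.indicator_of_mem (ann_subset_norm_lt hm hx) ψ).le
    · simp [hlarge m hm]
  · refine tendsto_const_nhds.congr' ?_
    filter_upwards [eventually_gt_atTop N] with m hm
    exact (hlarge m hm).symm

lemma bstarNorm_sub_indicator_le {N : ℕ} {c : ℝ} (hc : 0 ≤ c)
    (h : ∀ m, N < m → pieceSeq d ψ m ≤ ENNReal.ofReal c) :
    bstarNorm d (ψ - {x | ‖x‖ < 2 ^ N}.indicator ψ) ≤ c := by
  refine ENNReal.toReal_le_of_le_ofReal hc (iSup_le fun m => ?_)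
  rcases le_or_gt m N with hm | hm
  · rw [pieceSeq_eq_zero fun x hx => ?_]
    · exact zero_le
    · simp [Set.indicator_of_mem (ann_subset_norm_lt hm hx) ψ]
  · rw [pieceSeq_congr (φ := ψ) fun x hx => ?_]
    · exact h m hm
    · simp [Set.indicator_of_notMem (Set.disjoint_right.1 (disjoint_norm_lt_ann hm) hx) ψ]

lemma quoDist_le_limsupQuo (hψ : MemBStar d ψ) : quoDist d ψ ≤ limsupQuo d ψ := by
  refine le_of_forall_pos_le_add fun ε hε => ?_
  have hev : ∀ᶠ n in atTop, (ballSeq d ψ n).toReal < limsupQuo d ψ + ε :=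
    eventually_lt_of_limsup_lt (lt_add_of_pos_right _ hε) (isBoundedUnder_ballSeq hψ)
  obtain ⟨N, hN⟩ := eventually_atTop.1 hev
  have hc : 0 ≤ limsupQuo d ψ + ε := ENNReal.toReal_nonneg.trans (hN N le_rfl).le
  refine (csInf_le bddBelow_quoDist ⟨_, memBStar0_indicator hψ N, rfl⟩).trans
    (bstarNorm_sub_indicator_le hc fun m hm => (pieceSeq_le_ballSeq m).trans ?_)
  exact ENNReal.le_ofReal_iff_toReal_le (ballSeq_lt_top hψ m).ne hc |>.2 (hN m hm.le).le

lemma limsupQuo_le_quoDist (hψ : MemBStar d ψ) : limsupQuo d ψ ≤ 4 * quoDist d ψ := by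
  have h : limsupQuo d ψ / 4 ≤ quoDist d ψ := by
    refine le_csInf ⟨_, 0, memBStar0_zero, rfl⟩ ?_
    rintro _ ⟨φ, hφ, rfl⟩
    linarith [limsupQuo_le_bstarNorm_sub hψ hφ]
  linarith

end Dyadic

/-- the quantity `‖ψ‖_quo = limsup_n 2^{-n/2} ‖1_{{|x|<2ⁿ}} ψ‖_{L²}` is a norm
on the quotient `ℬ*/ℬ*₀` equivalent to the abstract quotient norm: there are `c, C > 0`
with `c·dist(ψ, ℬ*₀) ≤ ‖ψ‖_quo ≤ C·dist(ψ, ℬ*₀)` for all `ψ ∈ ℬ*`. -/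
theorem stmt18 (d : ℕ) (hd : 1 ≤ d) :
    ∃ c C : ℝ, 0 < c ∧ 0 < C ∧
      ∀ ψ : EuclideanSpace ℝ (Fin d) → ℝ, MemBStar d ψ →
        c * quoDist d ψ ≤ limsupQuo d ψ ∧ limsupQuo d ψ ≤ C * quoDist d ψ := by
  refine ⟨1, 4, one_pos, by norm_num, fun ψ hψ => ⟨?_, limsupQuo_le_quoDist hψ⟩⟩
  rw [one_mul]
  exact quoDist_le_limsupQuo hψ

end
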